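/- Let n be a nonnegative integer, let κ be a nonzero real number and b a real number. Define c_0 = 1 and, for 1 ≤ j ≤ n + 1, c_j = Π_{k=0}^{j−1} ( 2(n − k)/κ ). Then ∫₀^b t^n e^{iκt} J_{n+1}(κt) dt = c_n (ib − 1/κ) e^{iκb} J_0(κb) + Σ_{j=1}^{n} ( i b c_{n−j}/(2j+1) − c_{n−j}/κ + c_{n−j+1}/(2j−1) ) b^{j} e^{iκb} J_j(κb) + (1/(2n+1)) b^{n+1} e^{iκb} J_{n+1}(κb) + c_n/κ. -/

import Mathlib

open Real MeasureTheory Complex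

/-- Bessel function of the first kind of nonnegative integer order `m`. -/
noncomputable def besselJ (m : ℕ) (x : ℝ) : ℝ :=
  ∑' j : ℕ, ((-1 : ℝ) ^ j / ((j.factorial : ℝ) * ((j + m).factorial : ℝ))) * (x / 2) ^ (2 * j + m)

/-- The Bessel–Clifford function of order `m`. -/
noncomputable def besselClifford (m : ℕ) (y : ℝ) : ℝ :=
  ∑' j : ℕ, y ^ j / ((j.factorial : ℝ) * ((j + m).factorial : ℝ))

theorem abs_besselClifford_term_le (m j : ℕ) {y R : ℝ} (h : |y| ≤ R) :
    |y ^ j / ((j.factorial : ℝ) * ((j + m).factorial : ℝ))| ≤ R ^ j / (j.factorial : ℝ) := by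
  have hj : (0 : ℝ) < (j.factorial : ℝ) := by positivity
  have hm : (1 : ℝ) ≤ ((j + m).factorial : ℝ) := by exact_mod_cast Nat.factorial_pos _
  rw [abs_div, abs_pow, abs_of_pos (by positivity :
    (0 : ℝ) < (j.factorial : ℝ) * ((j + m).factorial : ℝ))]
  have hR : 0 ≤ R := (abs_nonneg y).trans h
  gcongr
  exact le_mul_of_one_le_right hj.le hm

theorem summable_besselClifford (m : ℕ) (y : ℝ) :
    Summable fun j : ℕ => y ^ j / ((j.factorial : ℝ) * ((j + m).factorial : ℝ)) :=
  .of_norm_bounded (Real.summable_pow_div_factorial |y|)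
    fun j => abs_besselClifford_term_le m j le_rfl

theorem natCast_div_factorial_mul_factorial (m j : ℕ) (a : ℝ) :
    ((j + 1 : ℕ) : ℝ) * a / (((j + 1).factorial : ℝ) * ((j + 1 + m).factorial : ℝ)) =
      a / ((j.factorial : ℝ) * ((j + (m + 1)).factorial : ℝ)) := by
  rw [show j + (m + 1) = j + 1 + m by ring, Nat.factorial_succ j]
  push_cast
  field_simp

theorem hasDerivAt_besselClifford (m : ℕ) (y : ℝ) :
    HasDerivAt (besselClifford m) (besselClifford (m + 1) y) y := by
  let g' : ℕ → ℝ → ℝ := fun j z =>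
    (j : ℝ) * z ^ (j - 1) / ((j.factorial : ℝ) * ((j + m).factorial : ℝ))
  have g'_succ (j : ℕ) (z : ℝ) :
      g' (j + 1) z = z ^ j / ((j.factorial : ℝ) * ((j + (m + 1)).factorial : ℝ)) :=
    natCast_div_factorial_mul_factorial m j (z ^ j)
  let u : ℕ → ℝ := fun j => (|y| + 1) ^ (j - 1) / ((j - 1).factorial : ℝ)
  have hu : Summable u :=
    (summable_nat_add_iff 1).1 (by simpa [u] using Real.summable_pow_div_factorial (|y| + 1))
  have hy : y ∈ Metric.ball (0 : ℝ) (|y| + 1) := by simp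
  have hg' : ∀ j z, z ∈ Metric.ball (0 : ℝ) (|y| + 1) → ‖g' j z‖ ≤ u j := by
    rintro (_ | j) z hz
    · simp [g', u]
    · rw [g'_succ]
      exact abs_besselClifford_term_le (m + 1) j (by simpa using (mem_ball_zero_iff.1 hz).le)
  have key := hasDerivAt_tsum_of_isPreconnected hu Metric.isOpen_ball
    (convex_ball (0 : ℝ) (|y| + 1)).isPreconnected
    (fun j z _ => (hasDerivAt_pow j z).div_const ((j.factorial : ℝ) * ((j + m).factorial : ℝ)))
    hg' hy (summable_besselClifford m y) hy
  refine key.congr_deriv ?_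
  change ∑' j, g' j y = _
  rw [((Summable.of_norm_bounded hu fun j => hg' j y hy)).tsum_eq_zero_add]
  simp [g'_succ, besselClifford, g']

theorem besselClifford_eq (m : ℕ) (y : ℝ) :
    besselClifford m y =
      (m + 1) * besselClifford (m + 1) y + y * besselClifford (m + 2) y := by
  have h0 := summable_besselClifford m y
  have h1 := summable_besselClifford (m + 1) y
  have h2 := summable_besselClifford (m + 2) y
  unfold besselClifford
  rw [h0.tsum_eq_zero_add, h1.tsum_eq_zero_add, mul_add, ← tsum_mul_left, ← tsum_mul_left,
    add_assoc, ← (((summable_nat_add_iff 1).2 h1).mul_left _).tsum_add (h2.mul_left _)]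
  congr 1
  · simp only [zero_add, Nat.factorial_succ m]
    push_cast
    field_simp
  · refine tsum_congr fun j => ?_
    rw [show j + 1 + (m + 1) = j + m + 1 + 1 by ring, show j + (m + 2) = j + m + 1 + 1 by ring,
      show j + 1 + m = j + m + 1 by ring, Nat.factorial_succ (j + m + 1), Nat.factorial_succ j]
    push_cast
    field_simp
    ring

theorem besselJ_eq_besselClifford (m : ℕ) (x : ℝ) :
    besselJ m x = (x / 2) ^ m * besselClifford m (-(x / 2) ^ 2) := by
  rw [besselJ, besselClifford, ← tsum_mul_left]
  refine tsum_congr fun j => ?_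
  rw [neg_pow ((x / 2) ^ 2), pow_add, pow_mul]
  ring

/-- The three-term recurrence `2 (m + 1) J_{m+1}(x) = x (J_m(x) + J_{m+2}(x))`. -/
theorem besselJ_recurrence (m : ℕ) (x : ℝ) :
    2 * (m + 1) * besselJ (m + 1) x = x * (besselJ m x + besselJ (m + 2) x) := by
  simp only [besselJ_eq_besselClifford]
  rw [besselClifford_eq m]
  ring

theorem hasDerivAt_besselClifford_neg_sq (m : ℕ) (x : ℝ) :
    HasDerivAt (fun x : ℝ => besselClifford m (-(x / 2) ^ 2))
      (-(x / 2) * besselClifford (m + 1) (-(x / 2) ^ 2)) x := by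
  have h : HasDerivAt (fun x : ℝ => -(x / 2) ^ 2) (-(x / 2)) x :=
    (((hasDerivAt_id x).div_const 2).pow 2).neg.congr_deriv (by simp; ring)
  exact ((hasDerivAt_besselClifford m _).comp x h).congr_deriv (by ring)

theorem hasDerivAt_besselJ_zero (x : ℝ) : HasDerivAt (besselJ 0) (-besselJ 1 x) x := by
  rw [show besselJ 0 = _ from funext (besselJ_eq_besselClifford 0), besselJ_eq_besselClifford]
  simpa using hasDerivAt_besselClifford_neg_sq 0 x

theorem hasDerivAt_besselJ_succ (m : ℕ) (x : ℝ) :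
    HasDerivAt (besselJ (m + 1)) ((besselJ m x - besselJ (m + 2) x) / 2) x := by
  rw [show besselJ (m + 1) = _ from funext (besselJ_eq_besselClifford (m + 1)),
    besselJ_eq_besselClifford, besselJ_eq_besselClifford]
  refine ((((hasDerivAt_id x).div_const 2).pow (m + 1)).mul
    (hasDerivAt_besselClifford_neg_sq (m + 1) x)).congr_deriv ?_
  simp only [Nat.add_sub_cancel, id, Pi.pow_apply, besselClifford_eq m]
  push_cast
  ring

theorem continuous_besselJ (m : ℕ) : Continuous (besselJ m) := by
  cases m with
  | zero => exact continuous_iff_continuousAt.2 fun x => (hasDerivAt_besselJ_zero x).continuousAt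
  | succ m => exact continuous_iff_continuousAt.2 fun x => (hasDerivAt_besselJ_succ m x).continuousAt

theorem besselJ_zero_zero : besselJ 0 0 = 1 := by
  rw [besselJ, tsum_eq_single 0 fun j hj => by simp [hj]]
  simp

/-- The function `t ^ m * e ^ (iκt) * J_p(κt)`. -/
noncomputable def powExpBessel (κ : ℝ) (m p : ℕ) (t : ℝ) : ℂ :=
  (t : ℂ) ^ m * Complex.exp (Complex.I * κ * t) * (besselJ p (κ * t) : ℂ)

theorem continuous_powExpBessel (κ : ℝ) (m p : ℕ) : Continuous (powExpBessel κ m p) := by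
  have := continuous_besselJ p
  unfold powExpBessel
  fun_prop

theorem hasDerivAt_powExpBessel (κ : ℝ) (m p : ℕ) {t d : ℝ} (h : HasDerivAt (besselJ p) d (κ * t)) :
    HasDerivAt (powExpBessel κ m p)
      (((m : ℂ) * (t : ℂ) ^ (m - 1) + Complex.I * κ * (t : ℂ) ^ m) *
          Complex.exp (Complex.I * κ * t) * (besselJ p (κ * t) : ℂ) +
        (t : ℂ) ^ m * Complex.exp (Complex.I * κ * t) * (κ * d : ℂ)) t := by
  have hJ : HasDerivAt (fun t : ℝ => (besselJ p (κ * t) : ℂ)) ((d * (κ * 1) : ℝ) : ℂ) t :=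
    (h.comp t ((hasDerivAt_id t).const_mul κ)).ofReal_comp
  have ht : HasDerivAt (fun t : ℝ => (t : ℂ)) 1 t := (hasDerivAt_id t).ofReal_comp
  refine (((ht.pow m).mul (ht.const_mul (Complex.I * κ)).cexp).mul hJ).congr_deriv ?_
  simp only [Pi.pow_apply, Pi.mul_apply]
  push_cast
  ring

/-- The boundary term produced when one reduces `∫ t ^ n e ^ (iκt) J_{n+1}(κt)` to the same integral
with `n` lowered by one. -/
noncomputable def reductionTerm (κ : ℝ) (n : ℕ) (t : ℝ) : ℂ :=
  Complex.I / (2 * n + 1) * powExpBessel κ (n + 1) n t - 1 / κ * powExpBessel κ n n t +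
    1 / (2 * n + 1) * powExpBessel κ (n + 1) (n + 1) t

theorem hasDerivAt_reductionTerm {κ : ℝ} (hκ : κ ≠ 0) (n : ℕ) (t : ℝ) :
    HasDerivAt (reductionTerm κ n)
      (powExpBessel κ n (n + 1) t - 2 * n / κ * powExpBessel κ (n - 1) n t) t := by
  have hκ' : (κ : ℂ) ≠ 0 := by exact_mod_cast hκ
  have hn : (2 * n + 1 : ℂ) ≠ 0 := by exact_mod_cast (by positivity : (2 * n + 1) ≠ 0)
  have hsucc := hasDerivAt_powExpBessel κ (n + 1) (n + 1) (hasDerivAt_besselJ_succ n (κ * t))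
  have hrec : (2 * (n + 1) * besselJ (n + 1) (κ * t) : ℂ) =
      κ * t * (besselJ n (κ * t) + besselJ (n + 2) (κ * t)) := by
    exact_mod_cast besselJ_recurrence n (κ * t)
  cases n with
  | zero =>
    have h := hasDerivAt_besselJ_zero (κ * t)
    refine ((((hasDerivAt_powExpBessel κ 1 0 h).const_mul _).sub
      ((hasDerivAt_powExpBessel κ 0 0 h).const_mul _)).add (hsucc.const_mul _)).congr_deriv ?_
    simp only [powExpBessel]
    push_cast
    field_simp
    simp
    simp only [Nat.cast_zero, zero_add] at hrec
    linear_combination (κ : ℂ) * hrec + 2 * (κ : ℂ) ^ 2 * t * besselJ 0 (κ * t) * Complex.I_sq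
  | succ m =>
    have h := hasDerivAt_besselJ_succ m (κ * t)
    have hrec' : (2 * (m + 1) * besselJ (m + 1) (κ * t) : ℂ) =
        κ * t * (besselJ m (κ * t) + besselJ (m + 2) (κ * t)) := by
      exact_mod_cast besselJ_recurrence m (κ * t)
    refine ((((hasDerivAt_powExpBessel κ (m + 1 + 1) (m + 1) h).const_mul _).sub
      ((hasDerivAt_powExpBessel κ (m + 1) (m + 1) h).const_mul _)).add
        (hsucc.const_mul _)).congr_deriv ?_
    simp only [powExpBessel]
    push_cast
    push_cast at hn hrec
    field_simp
    linear_combination (κ : ℂ) * t * (t : ℂ) ^ m * hrec +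
      (2 * m + 3 - Complex.I * κ * t) * (t : ℂ) ^ m * hrec' +
      2 * (κ : ℂ) ^ 2 * t ^ 2 * (t : ℂ) ^ m * besselJ (m + 1) (κ * t) * Complex.I_sq

theorem integral_powExpBessel_reduction {κ : ℝ} (hκ : κ ≠ 0) (n : ℕ) (b : ℝ) :
    ∫ t in (0:ℝ)..b, powExpBessel κ n (n + 1) t =
      2 * n / κ * (∫ t in (0:ℝ)..b, powExpBessel κ (n - 1) n t) +
        (reductionTerm κ n b - reductionTerm κ n 0) := by
  have h1 := (continuous_powExpBessel κ n (n + 1)).intervalIntegrable (μ := volume) 0 b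
  have h2 := ((continuous_powExpBessel κ (n - 1) n).intervalIntegrable (μ := volume) 0 b).const_mul
    (2 * n / κ : ℂ)
  rw [← intervalIntegral.integral_eq_sub_of_hasDerivAt
    (fun t _ => hasDerivAt_reductionTerm hκ n t) (h1.sub h2),
    intervalIntegral.integral_sub h1 h2, intervalIntegral.integral_const_mul]
  ring

theorem reductionTerm_zero_zero (κ : ℝ) : reductionTerm κ 0 0 = -(1 / κ) := by
  simp [reductionTerm, powExpBessel, besselJ_zero_zero]

theorem reductionTerm_succ_zero (κ : ℝ) (n : ℕ) : reductionTerm κ (n + 1) 0 = 0 := by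
  simp [reductionTerm, powExpBessel]

theorem integral_powExpBessel_eq_sum {κ : ℝ} (hκ : κ ≠ 0) (b : ℝ) (n : ℕ) :
    ∫ t in (0:ℝ)..b, powExpBessel κ n (n + 1) t =
      ∑ j ∈ Finset.range (n + 1),
        (∏ k ∈ Finset.range (n - j), (2 * ((n : ℂ) - k) / (κ : ℂ))) * reductionTerm κ j b +
      (∏ k ∈ Finset.range n, (2 * ((n : ℂ) - k) / (κ : ℂ))) / κ := by
  induction n with
  | zero =>
    rw [integral_powExpBessel_reduction hκ, reductionTerm_zero_zero]
    simp
  | succ n ih =>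
    have hprod (j : ℕ) : ∏ k ∈ Finset.range (j + 1), (2 * (((n + 1 : ℕ) : ℂ) - k) / (κ : ℂ)) =
        2 * (n + 1 : ℕ) / κ * ∏ k ∈ Finset.range j, (2 * ((n : ℂ) - k) / (κ : ℂ)) := by
      rw [Finset.prod_range_succ', mul_comm]
      simp
    rw [integral_powExpBessel_reduction hκ, reductionTerm_succ_zero, Nat.add_sub_cancel, ih,
      Finset.sum_range_succ _ (n + 1), hprod, mul_add, Finset.mul_sum]
    have hsum : ∀ j ∈ Finset.range (n + 1),
        (∏ k ∈ Finset.range (n + 1 - j), (2 * (((n + 1 : ℕ) : ℂ) - k) / (κ : ℂ))) *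
            reductionTerm κ j b =
          2 * (n + 1 : ℕ) / κ * ((∏ k ∈ Finset.range (n - j), (2 * ((n : ℂ) - k) / (κ : ℂ))) *
            reductionTerm κ j b) := by
      intro j hj
      rw [Nat.succ_sub (Nat.lt_succ_iff.1 (Finset.mem_range.1 hj)), hprod]
      ring
    rw [Finset.sum_congr rfl hsum]
    simp
    ring

theorem stmt_19 (n : ℕ) (κ b : ℝ) (hκ : κ ≠ 0) (c : ℕ → ℂ)
    (hc : ∀ j : ℕ, c j = ∏ k ∈ Finset.range j, (2 * ((n : ℂ) - k) / (κ : ℂ))) :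
    ∫ t in (0:ℝ)..b,
        (t : ℂ) ^ n * Complex.exp (Complex.I * κ * t) * (besselJ (n + 1) (κ * t) : ℂ) =
      c n * (Complex.I * b - 1 / (κ : ℂ)) * Complex.exp (Complex.I * κ * b) *
          (besselJ 0 (κ * b) : ℂ) +
        (∑ j ∈ Finset.Icc 1 n,
          (Complex.I * b * c (n - j) / (2 * (j : ℂ) + 1) - c (n - j) / (κ : ℂ) +
              c (n - j + 1) / (2 * (j : ℂ) - 1)) *
            (b : ℂ) ^ j * Complex.exp (Complex.I * κ * b) * (besselJ j (κ * b) : ℂ)) +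
        (1 / (2 * (n : ℂ) + 1)) * (b : ℂ) ^ (n + 1) * Complex.exp (Complex.I * κ * b) *
          (besselJ (n + 1) (κ * b) : ℂ) +
        c n / (κ : ℂ) := by
  have hc0 : c 0 = 1 := by simp [hc]
  have h := integral_powExpBessel_eq_sum hκ b n
  simp only [← hc] at h
  have hterm (j : ℕ) : c (n - j) * reductionTerm κ j b =
      (Complex.I * b * c (n - j) / (2 * (j : ℂ) + 1) - c (n - j) / κ) * powExpBessel κ j j b +
        c (n - j) / (2 * j + 1) * powExpBessel κ (j + 1) (j + 1) b := by
    simp only [reductionTerm, powExpBessel]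
    ring
  simp only [hterm, Finset.sum_add_distrib] at h
  rw [Finset.sum_range_succ', Finset.sum_range_succ _ n] at h
  refine h.trans ?_
  rw [← Finset.Ico_add_one_right_eq_Icc, Finset.sum_Ico_eq_sum_range]
  have hshift : ∀ j ∈ Finset.range n,
      (Complex.I * b * c (n - (1 + j)) / (2 * ((1 + j : ℕ) : ℂ) + 1) - c (n - (1 + j)) / (κ : ℂ) +
          c (n - (1 + j) + 1) / (2 * ((1 + j : ℕ) : ℂ) - 1)) *
        (b : ℂ) ^ (1 + j) * Complex.exp (Complex.I * κ * b) * (besselJ (1 + j) (κ * b) : ℂ) =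
      (Complex.I * b * c (n - (j + 1)) / (2 * ((j + 1 : ℕ) : ℂ) + 1) - c (n - (j + 1)) / κ) *
          powExpBessel κ (j + 1) (j + 1) b +
        c (n - j) / (2 * j + 1) * powExpBessel κ (j + 1) (j + 1) b := by
    intro j hj
    have hj' := Finset.mem_range.1 hj
    rw [add_comm 1 j, show n - (j + 1) + 1 = n - j by omega,
      show (2 * ((j + 1 : ℕ) : ℂ) - 1) = 2 * j + 1 by push_cast; ring, powExpBessel]
    ring
  rw [Nat.add_sub_cancel, Finset.sum_congr rfl hshift, Finset.sum_add_distrib]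
  simp [powExpBessel, hc0]
  ring
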